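/- Let q : ℝ → ℝⁿ be twice differentiable, M : ℝ → Matrix (Fin n) (Fin n) ℝ differentiable with M(t) symmetric, C, D : ℝ → Matrix (Fin n) (Fin n) ℝ with D(t) positive semidefinite for every t, F : ℝ → ℝⁿ, K_p symmetric, K_D symmetric positive definite, and q^d ∈ ℝⁿ. Assume for every t: (i) q̇(t)ᵀ (M'(t) − 2C(t)) q̇(t) = 0, and (ii) the closed-loop dynamics M(t) q̈(t) = u(t) + F(t) − (C(t) + D(t)) q̇(t) with the PD control law u(t) = −K_p (q(t) − q^d) − K_D q̇(t) − F(t). Then V(t) := ½ q̇ᵀ M q̇ + ½ (q − q^d)ᵀ K_p (q − q^d) satisfies V'(t) = −q̇(t)ᵀ (K_D + D(t)) q̇(t) ≤ 0 for every t; in particular V is antitone (nonincreasing) on ℝ. -/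

import Mathlib

open Matrix

/-- Product rule for the dot product of two vector-valued curves. -/
theorem hasDerivAt_dotProduct {ι : Type*} [Fintype ι] {v w : ℝ → ι → ℝ} {v' w' : ι → ℝ} {t : ℝ}
    (hv : HasDerivAt v v' t) (hw : HasDerivAt w w' t) :
    HasDerivAt (fun s => v s ⬝ᵥ w s) (v' ⬝ᵥ w t + v t ⬝ᵥ w') t := by
  have h := HasDerivAt.fun_sum (u := Finset.univ)
    fun i _ => (hasDerivAt_pi.1 hv i).mul (hasDerivAt_pi.1 hw i)
  rw [Finset.sum_add_distrib] at h
  exact h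

/-- Product rule for a matrix-valued curve, differentiable entrywise, applied to a
vector-valued curve. -/
theorem hasDerivAt_mulVec {ι κ : Type*} [Fintype ι] [Fintype κ] {A : ℝ → Matrix ι κ ℝ}
    {A' : Matrix ι κ ℝ} {v : ℝ → κ → ℝ} {v' : κ → ℝ} {t : ℝ}
    (hA : ∀ i j, HasDerivAt (fun s => A s i j) (A' i j) t) (hv : HasDerivAt v v' t) :
    HasDerivAt (fun s => A s *ᵥ v s) (A' *ᵥ v t + A t *ᵥ v') t :=
  hasDerivAt_pi.2 fun i => hasDerivAt_dotProduct (hasDerivAt_pi.2 (hA i)) hv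

theorem dotProduct_mulVec_comm_of_isSymm {ι : Type*} [Fintype ι] {A : Matrix ι ι ℝ}
    (hA : A.IsSymm) (v w : ι → ℝ) : v ⬝ᵥ (A *ᵥ w) = w ⬝ᵥ (A *ᵥ v) := by
  rw [dotProduct_mulVec, ← mulVec_transpose, hA.eq, dotProduct_comm]

/-- Derivative of half a time-dependent symmetric quadratic form along a curve. -/
theorem hasDerivAt_half_quadratic {ι : Type*} [Fintype ι] {A : ℝ → Matrix ι ι ℝ}
    {A' : Matrix ι ι ℝ} {v : ℝ → ι → ℝ} {v' : ι → ℝ} {t : ℝ}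
    (hA : ∀ i j, HasDerivAt (fun s => A s i j) (A' i j) t) (hsymm : (A t).IsSymm)
    (hv : HasDerivAt v v' t) :
    HasDerivAt (fun s => (1 / 2) * (v s ⬝ᵥ (A s *ᵥ v s)))
      (v t ⬝ᵥ (A t *ᵥ v') + (1 / 2) * (v t ⬝ᵥ (A' *ᵥ v t))) t := by
  refine ((hasDerivAt_dotProduct hv (hasDerivAt_mulVec hA hv)).const_mul (1 / 2)).congr_deriv ?_
  rw [dotProduct_mulVec_comm_of_isSymm hsymm v', dotProduct_add]
  ring

/-- Decrease of the Lyapunov function under the cable-driven PD control law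
`u = −K_p q̃ − K_D q̇ − F` (no gravity/buoyancy compensation): along the
closed-loop trajectory, `V(t) = ½ q̇ᵀ M q̇ + ½ q̃ᵀ K_p q̃` satisfies
`V'(t) = −q̇ᵀ (K_D + D) q̇ ≤ 0`; in particular `V` is nonincreasing on ℝ. -/
theorem lyapunov_decrease_pd_cable
    (n : ℕ)
    (q qdot qddot : ℝ → Fin n → ℝ)
    (M Mdot C D : ℝ → Matrix (Fin n) (Fin n) ℝ)
    (u F : ℝ → Fin n → ℝ)
    (Kp KD : Matrix (Fin n) (Fin n) ℝ)
    (hKp : Kp.IsSymm) (hKD : KD.PosDef)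
    (qd : Fin n → ℝ)
    (hq : ∀ t, HasDerivAt q (qdot t) t)
    (hqdot : ∀ t, HasDerivAt qdot (qddot t) t)
    (hM : ∀ t i j, HasDerivAt (fun s => M s i j) (Mdot t i j) t)
    (hMsymm : ∀ t, (M t).IsSymm)
    (hD : ∀ t, (D t).PosSemidef)
    (hskew : ∀ t, qdot t ⬝ᵥ ((Mdot t - (2 : ℝ) • C t) *ᵥ qdot t) = 0)
    (heom : ∀ t, M t *ᵥ qddot t = u t + F t - (C t + D t) *ᵥ qdot t)
    (hu : ∀ t, u t = -(Kp *ᵥ (q t - qd)) - KD *ᵥ qdot t - F t) :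
    (∀ t, HasDerivAt
      (fun s => (1 / 2) * (qdot s ⬝ᵥ (M s *ᵥ qdot s))
        + (1 / 2) * ((q s - qd) ⬝ᵥ (Kp *ᵥ (q s - qd))))
      (-(qdot t ⬝ᵥ ((KD + D t) *ᵥ qdot t))) t
      ∧ -(qdot t ⬝ᵥ ((KD + D t) *ᵥ qdot t)) ≤ 0) ∧
    Antitone (fun s => (1 / 2) * (qdot s ⬝ᵥ (M s *ᵥ qdot s))
        + (1 / 2) * ((q s - qd) ⬝ᵥ (Kp *ᵥ (q s - qd)))) := by
  have hV : ∀ t, HasDerivAt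
      (fun s => (1 / 2) * (qdot s ⬝ᵥ (M s *ᵥ qdot s))
        + (1 / 2) * ((q s - qd) ⬝ᵥ (Kp *ᵥ (q s - qd))))
      (-(qdot t ⬝ᵥ ((KD + D t) *ᵥ qdot t))) t := by
    intro t
    have hkin := hasDerivAt_half_quadratic (hM t) (hMsymm t) (hqdot t)
    have hpot := hasDerivAt_half_quadratic (A := fun _ => Kp) (A' := 0)
      (fun i j => hasDerivAt_const t (Kp i j)) hKp ((hq t).sub_const qd)
    refine (hkin.add hpot).congr_deriv ?_
    have hs := hskew t
    have hsymm := dotProduct_mulVec_comm_of_isSymm hKp (q t - qd) (qdot t)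
    rw [heom, hu, hsymm]
    simp only [sub_mulVec, add_mulVec, smul_mulVec, zero_mulVec, dotProduct_sub, dotProduct_add,
      dotProduct_neg, dotProduct_smul, dotProduct_zero, smul_eq_mul] at hs ⊢
    linarith
  have hneg : ∀ t, -(qdot t ⬝ᵥ ((KD + D t) *ᵥ qdot t)) ≤ 0 := fun t =>
    neg_nonpos.2 ((hKD.posSemidef.add (hD t)).dotProduct_mulVec_nonneg (qdot t))
  exact ⟨fun t => ⟨hV t, hneg t⟩, antitone_of_hasDerivAt_nonpos hV hneg⟩
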